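/- arXiv:1512.07219 — 2 statements merged into one kernel-verified Lean document; each statement's English description precedes it below -/
import Mathlib

section
/- Let $T>0$, let $q\ge2$ be an integer, and let $\tfrac23<H<\tfrac34$. Define $E_q(\varepsilon) := 2(2q-1)!\,\beta_q^2\int_{\mathcal{S}} G^{(q)}_{\varepsilon,\,s_2-s_1}(t_1-s_1,\,t_2-s_2)\; ds_1\, ds_2\, dt_1\, dt_2$ for $\varepsilon\ge0$. Then the constant $\overline{\sigma}_q^2 := E_q(0) = 2(2q-1)!\,\beta_q^2\int_{\mathcal{S}} G^{(q)}_{0,\,s_2-s_1}(t_1-s_1,\,t_2-s_2)\; ds_1\, ds_2\, dt_1\, dt_2$ is finite, and $\lim_{\varepsilon\to0^+} E_q(\varepsilon) = \overline{\sigma}_q^2$. (Here $E_q(\varepsilon) = \mathbb{E}[I_{2q-1}(f_{2q-1,\varepsilon})^2]$ is the variance of the $(2q-1)$-th Wiener chaos component of the approximating derivative of self-intersection local time of fractional Brownian motion.) -/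
open Real Set MeasureTheory Filter

/-- The covariance `𝔼[B_{u₁}(B_{x+u₂} - B_x)]` of a fractional Brownian motion of
Hurst parameter `H`. -/
noncomputable def mu (H x u₁ u₂ : ℝ) : ℝ :=
  (1/2) * ((x + u₂) ^ (2*H) - x ^ (2*H) - |x + u₂ - u₁| ^ (2*H) + |x - u₁| ^ (2*H))

/-- The kernel `G^{(q)}_{ε,x}(u₁,u₂) = (ε + u₁^{2H})^{-1/2-q} (ε + u₂^{2H})^{-1/2-q}
μ_H(x,u₁,u₂)^{2q-1}`. -/
noncomputable def G (H : ℝ) (q : ℕ) (ε x u₁ u₂ : ℝ) : ℝ :=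
  (ε + u₁ ^ (2*H)) ^ (-(1/2 : ℝ) - (q : ℝ)) * (ε + u₂ ^ (2*H)) ^ (-(1/2 : ℝ) - (q : ℝ)) *
    mu H x u₁ u₂ ^ (2*q - 1)

/-- The constant `β_q = (2^{q-1/2} (q-1)! √π)⁻¹`. -/
noncomputable def betaConst (q : ℕ) : ℝ :=
  ((2 : ℝ) ^ ((q : ℝ) - 1/2) * (Nat.factorial (q - 1)) * Real.sqrt π)⁻¹

/-- The region `𝒮 = {(s₁,s₂,t₁,t₂) ∈ [0,T]⁴ : s₁ ≤ t₁, s₂ ≤ t₂, s₁ ≤ s₂}`. -/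
def regS (T : ℝ) : Set (ℝ × ℝ × ℝ × ℝ) :=
  {p | p.1 ∈ Icc (0:ℝ) T ∧ p.2.1 ∈ Icc (0:ℝ) T ∧ p.2.2.1 ∈ Icc (0:ℝ) T ∧
    p.2.2.2 ∈ Icc (0:ℝ) T ∧ p.1 ≤ p.2.2.1 ∧ p.2.1 ≤ p.2.2.2 ∧ p.1 ≤ p.2.1}

/-- `E_q(ε) = 𝔼[I_{2q-1}(f_{2q-1,ε})²]`, the variance of the `(2q-1)`-th Wiener chaos
component of the approximating derivative of self-intersection local time. -/
noncomputable def Evar (H T : ℝ) (q : ℕ) (ε : ℝ) : ℝ :=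
  2 * (Nat.factorial (2*q - 1)) * betaConst q ^ 2 *
    ∫ p in regS T, G H q ε (p.2.1 - p.1) (p.2.2.1 - p.1) (p.2.2.2 - p.2.1)

/-- `y ↦ |y|^p` is Lipschitz with constant `p M^{p-1}` on `[-M, M]`. -/
lemma abs_abs_rpow_sub_abs_rpow_le {p M a b : ℝ} (hp : 1 ≤ p) (ha : |a| ≤ M) (hb : |b| ≤ M) :
    |(|a| ^ p - |b| ^ p)| ≤ p * M ^ (p - 1) * |a - b| := by
  have hM : 0 ≤ M := (abs_nonneg a).trans ha
  have key := (convex_Icc (0 : ℝ) M).norm_image_sub_le_of_norm_hasDerivWithin_le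
    (f := fun y : ℝ => y ^ p) (f' := fun y => p * y ^ (p - 1)) (C := p * M ^ (p - 1))
    (fun y _ => (Real.hasDerivAt_rpow_const (Or.inr hp)).hasDerivWithinAt)
    (fun y hy => by
      rw [Real.norm_of_nonneg (mul_nonneg (by linarith) (Real.rpow_nonneg hy.1 _))]
      exact mul_le_mul_of_nonneg_left (Real.rpow_le_rpow hy.1 hy.2 (by linarith)) (by linarith))
    ⟨abs_nonneg b, hb⟩ ⟨abs_nonneg a, ha⟩
  exact key.trans (mul_le_mul_of_nonneg_left (abs_abs_sub_abs_le a b)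
    (mul_nonneg (by linarith) (Real.rpow_nonneg hM _)))

/-- Away from the origin, `y ↦ y^r` with `0 ≤ r ≤ 1` is Lipschitz. -/
lemma abs_rpow_sub_rpow_le {r m a b : ℝ} (hr0 : 0 ≤ r) (hr1 : r ≤ 1) (hm : 0 < m)
    (ha : m ≤ a) (hb : m ≤ b) : |a ^ r - b ^ r| ≤ r * m ^ (r - 1) * |a - b| := by
  refine (convex_Ici m).norm_image_sub_le_of_norm_hasDerivWithin_le
    (f := fun y : ℝ => y ^ r) (f' := fun y => r * y ^ (r - 1)) (C := r * m ^ (r - 1))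
    (fun y hy => (Real.hasDerivAt_rpow_const
      (Or.inl (hm.trans_le hy).ne')).hasDerivWithinAt)
    (fun y hy => ?_) hb ha
  rw [Real.norm_of_nonneg (mul_nonneg hr0 (Real.rpow_nonneg (hm.le.trans hy) _))]
  exact mul_le_mul_of_nonneg_left (Real.rpow_le_rpow_of_nonpos hm hy (by linarith)) hr0

/-- Mixed second differences of `y ↦ y^p`, away from the origin. -/
lemma abs_rpow_second_diff_le {p m x u v : ℝ} (hp1 : 1 ≤ p) (hp2 : p ≤ 2) (hm : 0 < m)
    (hu : 0 ≤ u) (hv : 0 ≤ v) (hx : m ≤ x - u) :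
    |((x + v) ^ p - (x + v - u) ^ p) - (x ^ p - (x - u) ^ p)|
      ≤ p * (p - 1) * m ^ (p - 2) * u * v := by
  have key := (convex_Ici x).norm_image_sub_le_of_norm_hasDerivWithin_le
    (f := fun y : ℝ => y ^ p - (y - u) ^ p)
    (f' := fun y => p * y ^ (p - 1) - p * (y - u) ^ (p - 1))
    (C := p * (p - 1) * m ^ (p - 2) * u) (x := x) (y := x + v)
    (fun y _ => by
      have h1 : HasDerivAt (fun y : ℝ => y ^ p) (p * y ^ (p - 1)) y :=
        Real.hasDerivAt_rpow_const (Or.inr hp1)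
      have h2 : HasDerivAt (fun y : ℝ => (y - u) ^ p) (p * (y - u) ^ (p - 1)) y := by
        simpa using ((hasDerivAt_id y).sub_const u).rpow_const (p := p) (Or.inr hp1)
      exact (h1.sub h2).hasDerivWithinAt)
    (fun y hy => by
      have hy' : x ≤ y := hy
      have h := abs_rpow_sub_rpow_le (r := p - 1) (a := y) (b := y - u) (by linarith)
        (by linarith) hm (by linarith) (by linarith)
      rw [sub_sub_cancel, abs_of_nonneg hu, show p - 1 - 1 = p - 2 by ring] at h
      rw [← mul_sub, Real.norm_eq_abs, abs_mul, abs_of_nonneg (by linarith : (0 : ℝ) ≤ p)]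
      calc p * |y ^ (p - 1) - (y - u) ^ (p - 1)| ≤ p * ((p - 1) * m ^ (p - 2) * u) :=
            mul_le_mul_of_nonneg_left h (by linarith)
        _ = _ := by ring)
    (mem_Ici.2 le_rfl) (mem_Ici.2 (by linarith))
  simpa [abs_of_nonneg hv] using key

/-- The covariance is dominated by `u₁ u₂ (x + u₁ + u₂)^{2H-2}`. -/
lemma abs_mu_le {H x u v : ℝ} (hH : 1 / 2 ≤ H) (hH1 : H ≤ 1) (hx : 0 < x) (hu : 0 < u)
    (hv : 0 < v) : |mu H x u v| ≤ 12 * (u * v * (x + u + v) ^ (2 * H - 2)) := by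
  set p := 2 * H with hp
  set M := x + u + v with hM
  have hM0 : 0 < M := by positivity
  have hR : 0 < M ^ (p - 2) := Real.rpow_pos_of_pos hM0 _
  have hR1 : M ^ (p - 1) = M ^ (p - 2) * M := by
    rw [← Real.rpow_add_one hM0.ne']; congr 1; ring
  have hmu : mu H x u v = (1 / 2) * ((|x + v| ^ p - |x| ^ p) -
      (|x + v - u| ^ p - |x - u| ^ p)) := by
    rw [mu, abs_of_pos (by positivity : 0 < x + v), abs_of_pos hx]; ring
  have hmu' : mu H x u v = (1 / 2) * ((|x + v| ^ p - |x + v - u| ^ p) -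
      (|x| ^ p - |x - u| ^ p)) := by rw [hmu]; ring
  have hb1 : |x + v| ≤ M := abs_le.2 ⟨by linarith, by linarith⟩
  have hb2 : |x| ≤ M := abs_le.2 ⟨by linarith, by linarith⟩
  have hb3 : |x + v - u| ≤ M := abs_le.2 ⟨by linarith, by linarith⟩
  have hb4 : |x - u| ≤ M := abs_le.2 ⟨by linarith, by linarith⟩
  have hp1 : 1 ≤ p := by linarith
  have hv_bound : |mu H x u v| ≤ p * (M ^ (p - 2) * M) * v := by
    have e1 := abs_abs_rpow_sub_abs_rpow_le hp1 hb1 hb2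
    have e2 := abs_abs_rpow_sub_abs_rpow_le hp1 hb3 hb4
    rw [show x + v - x = v by ring, abs_of_pos hv, hR1] at e1
    rw [show x + v - u - (x - u) = v by ring, abs_of_pos hv, hR1] at e2
    rw [hmu, abs_mul, abs_of_pos (by norm_num : (0 : ℝ) < 1 / 2)]
    linarith [abs_sub (|x + v| ^ p - |x| ^ p) (|x + v - u| ^ p - |x - u| ^ p)]
  have hu_bound : |mu H x u v| ≤ p * (M ^ (p - 2) * M) * u := by
    have e1 := abs_abs_rpow_sub_abs_rpow_le hp1 hb1 hb3
    have e2 := abs_abs_rpow_sub_abs_rpow_le hp1 hb2 hb4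
    rw [sub_sub_cancel, abs_of_pos hu, hR1] at e1
    rw [sub_sub_cancel, abs_of_pos hu, hR1] at e2
    rw [hmu', abs_mul, abs_of_pos (by norm_num : (0 : ℝ) < 1 / 2)]
    linarith [abs_sub (|x + v| ^ p - |x + v - u| ^ p) (|x| ^ p - |x - u| ^ p)]
  have large : ∀ {a b : ℝ}, 0 < a → M ≤ 6 * b →
      p * (M ^ (p - 2) * M) * a ≤ 12 * (a * b * M ^ (p - 2)) := by
    intro a b ha hb
    have hpa : 0 ≤ M ^ (p - 2) * a := by positivity
    have h1 : p * M ≤ 2 * (6 * b) := mul_le_mul (by linarith) hb hM0.le (by norm_num)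
    nlinarith [mul_le_mul_of_nonneg_left h1 hpa]
  by_cases h1 : M ≤ 6 * u
  · rw [mul_comm u v]; exact hv_bound.trans (large hv h1)
  by_cases h2 : M ≤ 6 * v
  · exact hu_bound.trans (large hu h2)
  have hm : M / 3 ≤ x - u := by linarith
  have hxu : 0 < x - u := by linarith
  have h3 := abs_rpow_second_diff_le hp1 (by linarith : p ≤ 2) (by positivity : 0 < M / 3)
    hu.le hv.le hm
  have h4 : (M / 3) ^ (p - 2) ≤ 3 * M ^ (p - 2) := by
    rw [Real.div_rpow hM0.le (by norm_num), div_eq_mul_inv, ← Real.rpow_neg (by norm_num),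
      mul_comm]
    refine mul_le_mul_of_nonneg_right ?_ hR.le
    calc (3 : ℝ) ^ (-(p - 2)) ≤ 3 ^ (1 : ℝ) :=
          Real.rpow_le_rpow_of_exponent_le (by norm_num) (by linarith)
      _ = 3 := Real.rpow_one 3
  rw [hmu', abs_mul, abs_of_pos (by norm_num : (0 : ℝ) < 1 / 2), abs_of_pos hx, abs_of_pos hxu,
    abs_of_pos (by linarith : 0 < x + v), abs_of_pos (by linarith : 0 < x + v - u)]
  have h5 : p * (p - 1) ≤ 2 := by nlinarith
  have huv : 0 < u * v := by positivity
  have h6 : p * (p - 1) * (M / 3) ^ (p - 2) ≤ 2 * (3 * M ^ (p - 2)) :=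
    mul_le_mul h5 h4 (by positivity) (by norm_num)
  nlinarith [mul_le_mul_of_nonneg_right h6 huv.le, mul_pos huv hR]

/-- Weighted form of the covariance bound, obtained by splitting the exponent `2 - 2H`. -/
lemma abs_mu_le_rpow {H x u v a b c : ℝ} (hH : 1 / 2 ≤ H) (hH1 : H ≤ 1) (hx : 0 < x)
    (hu : 0 < u) (hv : 0 < v) (ha : 0 ≤ a) (hb : 0 ≤ b) (hc : 0 ≤ c)
    (habc : a + b + c = 2 - 2 * H) :
    |mu H x u v| ≤ 12 * (x ^ (-a) * u ^ (1 - b) * v ^ (1 - c)) := by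
  refine (abs_mu_le hH hH1 hx hu hv).trans ?_
  have hM0 : 0 < x + u + v := by positivity
  have e1 : (x + u + v) ^ (-a) ≤ x ^ (-a) :=
    Real.rpow_le_rpow_of_nonpos hx (by linarith) (by linarith)
  have e2 : (x + u + v) ^ (-b) ≤ u ^ (-b) :=
    Real.rpow_le_rpow_of_nonpos hu (by linarith) (by linarith)
  have e3 : (x + u + v) ^ (-c) ≤ v ^ (-c) :=
    Real.rpow_le_rpow_of_nonpos hv (by linarith) (by linarith)
  rw [show 2 * H - 2 = -a + -b + -c by linarith, Real.rpow_add hM0, Real.rpow_add hM0,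
    sub_eq_add_neg 1 b, sub_eq_add_neg 1 c, Real.rpow_add hu, Real.rpow_add hv,
    Real.rpow_one, Real.rpow_one]
  calc 12 * (u * v * ((x + u + v) ^ (-a) * (x + u + v) ^ (-b) * (x + u + v) ^ (-c)))
      ≤ 12 * (u * v * (x ^ (-a) * u ^ (-b) * v ^ (-c))) := by gcongr
    _ = _ := by ring

/-- Pointwise domination of the limiting kernel by an integrable product of powers. -/
lemma abs_G_zero_le {H x u v : ℝ} {q : ℕ} (hq : 2 ≤ q) (hH : 1 / 2 ≤ H) (hH1 : H ≤ 9 / 11)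
    (hx : 0 < x) (hu : 0 < u) (hv : 0 < v) :
    |G H q 0 x u v| ≤
      12 ^ (2 * q - 1) * (x ^ (-(4 * H / 3)) * u ^ (-(4 * H / 3)) * v ^ (-(4 * H / 3))) := by
  obtain ⟨k, rfl⟩ := Nat.exists_eq_add_of_le hq
  have hn : 2 * (2 + k) - 1 = 2 * k + 3 := by omega
  have m1 : |mu H x u v| ≤ 12 * (u ^ H * v ^ H) := by
    have := abs_mu_le_rpow hH (by linarith) hx hu hv (a := 0) (b := 1 - H) (c := 1 - H) le_rfl
      (by linarith) (by linarith) (by ring)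
    simpa using this
  have m2 : |mu H x u v| ≤ 12 * (x ^ (-(4 * H / 9)) * u ^ (11 * H / 9) * v ^ (11 * H / 9)) := by
    have := abs_mu_le_rpow hH (by linarith) hx hu hv (a := 4 * H / 9) (b := 1 - 11 * H / 9)
      (c := 1 - 11 * H / 9) (by linarith) (by linarith) (by linarith) (by ring)
    simpa using this
  have split : ∀ {w : ℝ}, 0 < w →
      (w ^ (2 * H)) ^ (-(1 / 2 : ℝ) - ((2 + k : ℕ) : ℝ)) * ((w ^ H) ^ (2 * k) *
        (w ^ (11 * H / 9)) ^ 3) = w ^ (-(4 * H / 3)) := by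
    intro w hw
    rw [← Real.rpow_natCast, ← Real.rpow_natCast, ← Real.rpow_mul hw.le, ← Real.rpow_mul hw.le,
      ← Real.rpow_mul hw.le, ← Real.rpow_add hw, ← Real.rpow_add hw]
    congr 1; push_cast; ring
  have hx3 : (x ^ (-(4 * H / 9))) ^ 3 = x ^ (-(4 * H / 3)) := by
    rw [← Real.rpow_natCast, ← Real.rpow_mul hx.le]; congr 1; push_cast; ring
  rw [G, hn, zero_add, zero_add, abs_mul, abs_mul, abs_pow,
    abs_of_nonneg (by positivity : 0 ≤ (u ^ (2 * H)) ^ (-(1 / 2 : ℝ) - ((2 + k : ℕ) : ℝ))),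
    abs_of_nonneg (by positivity : 0 ≤ (v ^ (2 * H)) ^ (-(1 / 2 : ℝ) - ((2 + k : ℕ) : ℝ))),
    pow_add]
  refine (mul_le_mul_of_nonneg_left (mul_le_mul (pow_le_pow_left₀ (abs_nonneg _) m1 (2 * k))
    (pow_le_pow_left₀ (abs_nonneg _) m2 3) (by positivity) (by positivity))
    (by positivity)).trans_eq ?_
  rw [← split hu, ← split hv, ← hx3]
  ring

/-- For `ε ≥ 0` the regularised kernel is dominated by the limiting one. -/
lemma abs_G_le_abs_G_zero {H x u v ε : ℝ} (q : ℕ) (hε : 0 ≤ ε) (hu : 0 < u) (hv : 0 < v) :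
    |G H q ε x u v| ≤ |G H q 0 x u v| := by
  have hs : -(1 / 2 : ℝ) - (q : ℝ) ≤ 0 := by linarith [(Nat.cast_nonneg q : (0 : ℝ) ≤ q)]
  have key : ∀ {w : ℝ}, 0 < w → |(ε + w ^ (2 * H)) ^ (-(1 / 2 : ℝ) - (q : ℝ))| ≤
      |(0 + w ^ (2 * H)) ^ (-(1 / 2 : ℝ) - (q : ℝ))| := by
    intro w hw
    rw [abs_of_nonneg (by positivity), abs_of_nonneg (by positivity)]
    exact Real.rpow_le_rpow_of_nonpos (by positivity) (by linarith) hs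
  simp only [G, abs_mul]
  exact mul_le_mul_of_nonneg_right
    (mul_le_mul (key hu) (key hv) (abs_nonneg _) (abs_nonneg _)) (abs_nonneg _)

lemma tendsto_G_zero {H x u v : ℝ} (q : ℕ) (hu : 0 < u) (hv : 0 < v) :
    Tendsto (fun ε => G H q ε x u v) (nhdsWithin 0 (Ioi 0)) (nhds (G H q 0 x u v)) := by
  refine (ContinuousAt.tendsto ?_).mono_left nhdsWithin_le_nhds
  have key : ∀ {w : ℝ}, 0 < w →
      ContinuousAt (fun ε : ℝ => (ε + w ^ (2 * H)) ^ (-(1 / 2 : ℝ) - (q : ℝ))) 0 := by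
    intro w hw
    refine (continuousAt_id.add continuousAt_const).rpow_const (Or.inl ?_)
    have : 0 < w ^ (2 * H) := Real.rpow_pos_of_pos hw _
    simpa using this.ne'
  exact ((key hu).mul (key hv)).mul continuousAt_const

lemma measurable_G_comp (H : ℝ) (q : ℕ) (ε : ℝ) : Measurable (fun p : ℝ × ℝ × ℝ × ℝ =>
    G H q ε (p.2.1 - p.1) (p.2.2.1 - p.1) (p.2.2.2 - p.2.1)) := by
  unfold G mu
  fun_prop

lemma measurableSet_regS (T : ℝ) : MeasurableSet (regS T) := by
  unfold regS
  measurability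

/-- The change of variables `(s₁, s₂, t₁, t₂) ↦ (s₁, s₂ - s₁, t₁ - s₁, t₂ - s₂)`. -/
lemma measurePreserving_increments : MeasurePreserving
    (fun p : ℝ × ℝ × ℝ × ℝ => (p.1, p.2.1 - p.1, p.2.2.1 - p.1, p.2.2.2 - p.2.1)) := by
  have h2 : ∀ s : ℝ, MeasurePreserving
      (fun p : ℝ × ℝ × ℝ => (p.1 - s, p.2.1 - s, p.2.2 - p.1)) := fun s =>
    (measurePreserving_sub_right volume s).skew_product
      (g := fun (r : ℝ) (p : ℝ × ℝ) => (p.1 - s, p.2 - r)) (by fun_prop)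
      (ae_of_all _ fun r => ((measurePreserving_sub_right volume s).prod
        (measurePreserving_sub_right volume r)).map_eq)
  exact (MeasurePreserving.id volume).skew_product
    (g := fun (s : ℝ) (p : ℝ × ℝ × ℝ) => (p.1 - s, p.2.1 - s, p.2.2 - p.1)) (by fun_prop)
    (ae_of_all _ fun s => (h2 s).map_eq)

/-- Almost everywhere on `regS T` all three increments are positive. -/
lemma ae_regS_increments_pos (T : ℝ) : ∀ᵐ p ∂(volume.restrict (regS T)),
    p ∈ regS T ∧ 0 < p.2.1 - p.1 ∧ 0 < p.2.2.1 - p.1 ∧ 0 < p.2.2.2 - p.2.1 := by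
  have hne : ∀ᵐ y : ℝ, y ≠ 0 := Measure.ae_ne volume 0
  have q0 := measurePreserving_increments.quasiMeasurePreserving
  have q1 := Measure.quasiMeasurePreserving_snd.comp q0
  have q2 := Measure.quasiMeasurePreserving_snd.comp q1
  filter_upwards [ae_restrict_mem (measurableSet_regS T),
    ae_restrict_of_ae ((Measure.quasiMeasurePreserving_fst.comp q1).ae hne),
    ae_restrict_of_ae ((Measure.quasiMeasurePreserving_fst.comp q2).ae hne),
    ae_restrict_of_ae ((Measure.quasiMeasurePreserving_snd.comp q2).ae hne)] with p hp h1 h2 h3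
  obtain ⟨-, -, -, -, e1, e2, e3⟩ := id hp
  exact ⟨hp, lt_of_le_of_ne (sub_nonneg.2 e3) (Ne.symm h1),
    lt_of_le_of_ne (sub_nonneg.2 e1) (Ne.symm h2), lt_of_le_of_ne (sub_nonneg.2 e2) (Ne.symm h3)⟩

lemma integrable_indicator_rpow {r : ℝ} (hr : -1 < r) {T : ℝ} (hT : 0 ≤ T) :
    Integrable ((Ioc 0 T).indicator fun y : ℝ => y ^ r) :=
  ((intervalIntegrable_iff_integrableOn_Ioc_of_le hT).1
    (intervalIntegral.intervalIntegrable_rpow' hr)).integrable_indicator measurableSet_Ioc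

lemma integrableOn_rpow_increments {r : ℝ} (hr : -1 < r) {T : ℝ} (hT : 0 ≤ T) :
    IntegrableOn (fun p : ℝ × ℝ × ℝ × ℝ =>
      (p.2.1 - p.1) ^ r * (p.2.2.1 - p.1) ^ r * (p.2.2.2 - p.2.1) ^ r) (regS T) := by
  have h := integrable_indicator_rpow hr hT
  have h0 : Integrable ((Icc 0 T).indicator fun _ : ℝ => (1 : ℝ)) :=
    (integrableOn_const (by simp)).integrable_indicator measurableSet_Icc
  have hprod := measurePreserving_increments.integrable_comp_of_integrable
    (h0.mul_prod (h.mul_prod (h.mul_prod h)))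
  refine hprod.integrableOn.congr ?_
  filter_upwards [ae_regS_increments_pos T] with p ⟨⟨hs1, hs2, ht1, ht2, _⟩, h1, h2, h3⟩
  have i0 : p.1 ∈ Icc 0 T := hs1
  have i1 : p.2.1 - p.1 ∈ Ioc 0 T := ⟨h1, by linarith [hs1.1, hs2.2]⟩
  have i2 : p.2.2.1 - p.1 ∈ Ioc 0 T := ⟨h2, by linarith [hs1.1, ht1.2]⟩
  have i3 : p.2.2.2 - p.2.1 ∈ Ioc 0 T := ⟨h3, by linarith [hs2.1, ht2.2]⟩
  simp only [Function.comp_apply, indicator_of_mem i0, indicator_of_mem i1,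
    indicator_of_mem i2, indicator_of_mem i3]
  ring

/-- For `q ≥ 2` and `2/3 < H < 3/4`, the constant `σ̄_q² = E_q(0)` is finite and
`E_q(ε) → E_q(0)` as `ε → 0⁺`. -/
theorem tendsto_variance_chaos_low (T : ℝ) (hT : 0 < T) (q : ℕ) (hq : 2 ≤ q) (H : ℝ)
    (hH : H ∈ Ioo (2/3 : ℝ) (3/4 : ℝ)) :
    IntegrableOn
      (fun p : ℝ × ℝ × ℝ × ℝ => G H q 0 (p.2.1 - p.1) (p.2.2.1 - p.1) (p.2.2.2 - p.2.1))
      (regS T) volume ∧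
    Tendsto (fun ε : ℝ => Evar H T q ε) (nhdsWithin 0 (Ioi 0)) (nhds (Evar H T q 0)) := by
  have hint : IntegrableOn
      (fun p : ℝ × ℝ × ℝ × ℝ => G H q 0 (p.2.1 - p.1) (p.2.2.1 - p.1) (p.2.2.2 - p.2.1))
      (regS T) volume := by
    refine Integrable.mono' ((integrableOn_rpow_increments (r := -(4 * H / 3))
      (by linarith [hH.2]) hT.le).const_mul (12 ^ (2 * q - 1)))
      (measurable_G_comp H q 0).aestronglyMeasurable ?_
    filter_upwards [ae_regS_increments_pos T] with p ⟨_, h1, h2, h3⟩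
    exact abs_G_zero_le hq (by linarith [hH.1]) (by linarith [hH.2]) h1 h2 h3
  refine ⟨hint, Tendsto.const_mul _ ?_⟩
  refine tendsto_integral_filter_of_dominated_convergence _
    (Eventually.of_forall fun ε => (measurable_G_comp H q ε).aestronglyMeasurable)
    ?_ hint.norm ?_
  · filter_upwards [self_mem_nhdsWithin] with ε hε
    filter_upwards [ae_regS_increments_pos T] with p ⟨_, _, h2, h3⟩
    exact abs_G_le_abs_G_zero q (le_of_lt hε) h2 h3
  · filter_upwards [ae_regS_increments_pos T] with p ⟨_, _, h2, h3⟩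
    exact tendsto_G_zero q h2 h3
end

section
/- Let $q\ge2$ be an integer and let $\tfrac34<H<\tfrac{4q-3}{4q-2}$. Then $\int_{\mathbb{R}_+^3} G^{(q)}_{1,x}(u_1,u_2)\, dx\, du_1\, du_2 < \infty$, i.e. the function $(x,u_1,u_2)\mapsto G^{(q)}_{1,x}(u_1,u_2)$ is integrable on $(0,\infty)^3$. -/
open Real Set MeasureTheory

lemma abs_abs_rpow_sub_abs_rpow_le_s14 {K T y z : ℝ} (hK : 1 ≤ K) (hy : |y| ≤ T) (hz : |z| ≤ T) :
    |(|y| ^ K - |z| ^ K)| ≤ K * T ^ (K - 1) * |y - z| := by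
  have key := Convex.norm_image_sub_le_of_norm_hasDerivWithin_le (𝕜 := ℝ)
    (f := fun t : ℝ => t ^ K) (f' := fun t => K * t ^ (K - 1)) (s := Icc 0 T) (x := |z|) (y := |y|)
    (C := K * T ^ (K - 1))
    (fun t _ => (Real.hasDerivAt_rpow_const (Or.inr hK)).hasDerivWithinAt)
    (fun t ht => by
      have : 0 ≤ t ^ (K - 1) := rpow_nonneg ht.1 _
      rw [Real.norm_of_nonneg (by positivity)]
      exact mul_le_mul_of_nonneg_left (rpow_le_rpow ht.1 ht.2 (by linarith)) (by linarith))
    (convex_Icc _ _) ⟨abs_nonneg _, hz⟩ ⟨abs_nonneg _, hy⟩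
  simp only [Real.norm_eq_abs] at key
  have hT : 0 ≤ T := (abs_nonneg y).trans hy
  exact key.trans (mul_le_mul_of_nonneg_left (abs_abs_sub_abs_le_abs_sub y z) (by positivity))

lemma abs_mu_le_of_le {H x u₁ u₂ T : ℝ} (hH : 1 ≤ 2 * H) (hx : 0 ≤ x) (h₁ : 0 ≤ u₁) (h₂ : 0 ≤ u₂)
    (hT : x + u₁ + u₂ ≤ T) :
    |mu H x u₁ u₂| ≤ 2 * H * T ^ (2 * H - 1) * min u₁ u₂ := by
  have ha : |x + u₂| ≤ T := abs_le.2 ⟨by linarith, by linarith⟩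
  have hb : |x| ≤ T := abs_le.2 ⟨by linarith, by linarith⟩
  have hc : |x + u₂ - u₁| ≤ T := abs_le.2 ⟨by linarith, by linarith⟩
  have hd : |x - u₁| ≤ T := abs_le.2 ⟨by linarith, by linarith⟩
  have e₁ : |x + u₂ - x| = u₂ := by rw [add_sub_cancel_left, abs_of_nonneg h₂]
  have e₂ : |x + u₂ - u₁ - (x - u₁)| = u₂ := by
    rw [show x + u₂ - u₁ - (x - u₁) = u₂ by ring, abs_of_nonneg h₂]
  have e₃ : |x + u₂ - (x + u₂ - u₁)| = u₁ := by
    rw [sub_sub_cancel, abs_of_nonneg h₁]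
  have e₄ : |x - (x - u₁)| = u₁ := by rw [sub_sub_cancel, abs_of_nonneg h₁]
  have i₁ := abs_le.1 (abs_abs_rpow_sub_abs_rpow_le_s14 hH ha hb)
  have i₂ := abs_le.1 (abs_abs_rpow_sub_abs_rpow_le_s14 hH hc hd)
  have i₃ := abs_le.1 (abs_abs_rpow_sub_abs_rpow_le_s14 hH ha hc)
  have i₄ := abs_le.1 (abs_abs_rpow_sub_abs_rpow_le_s14 hH hb hd)
  rw [e₁] at i₁
  rw [e₂] at i₂
  rw [e₃] at i₃
  rw [e₄] at i₄
  rw [abs_of_nonneg (show 0 ≤ x + u₂ by positivity)] at i₁ i₃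
  rw [abs_of_nonneg hx] at i₁ i₄
  unfold mu
  rcases min_cases u₁ u₂ with ⟨h, -⟩ | ⟨h, -⟩ <;> rw [h, abs_le] <;> constructor <;> linarith

lemma abs_mu_le_of_lt {H x u₁ u₂ : ℝ} (hH : 1 ≤ 2 * H) (hH' : 2 * H ≤ 2) (h₁ : 0 ≤ u₁)
    (h₂ : 0 ≤ u₂) (hx : u₁ < x) :
    |mu H x u₁ u₂| ≤ u₁ * u₂ * (x - u₁) ^ (2 * H - 2) := by
  set K := 2 * H with hK
  have hd : 0 < x - u₁ := sub_pos.2 hx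
  have inner (y : ℝ) (hy : x ≤ y) :
      ‖y ^ (K - 1) - (y - u₁) ^ (K - 1)‖ ≤ (K - 1) * (x - u₁) ^ (K - 2) * u₁ := by
    have := Convex.norm_image_sub_le_of_norm_hasDerivWithin_le (𝕜 := ℝ)
      (f := fun t : ℝ => t ^ (K - 1)) (f' := fun t => (K - 1) * t ^ (K - 1 - 1))
      (s := Ici (x - u₁)) (x := y - u₁) (y := y) (C := (K - 1) * (x - u₁) ^ (K - 2))
      (fun t ht => (Real.hasDerivAt_rpow_const
        (Or.inl (hd.trans_le ht).ne')).hasDerivWithinAt)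
      (fun t ht => by
        have h0 : 0 ≤ t ^ (K - 1 - 1) := rpow_nonneg (hd.le.trans ht) _
        rw [Real.norm_of_nonneg (mul_nonneg (by linarith) h0), show K - 1 - 1 = K - 2 by ring]
        exact mul_le_mul_of_nonneg_left (rpow_le_rpow_of_nonpos hd ht (by linarith))
          (by linarith))
      (convex_Ici _) (by simp only [mem_Ici]; linarith) (by simp only [mem_Ici]; linarith)
    simpa [abs_of_nonneg h₁] using this
  have outer := Convex.norm_image_sub_le_of_norm_hasDerivWithin_le (𝕜 := ℝ)
      (f := fun t : ℝ => t ^ K - (t - u₁) ^ K)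
      (f' := fun t => K * t ^ (K - 1) - K * (t - u₁) ^ (K - 1))
      (s := Ici x) (x := x) (y := x + u₂) (C := K * ((K - 1) * (x - u₁) ^ (K - 2) * u₁))
      (fun t ht => by
        have d₁ := Real.hasDerivAt_rpow_const (x := t) (Or.inr hH)
        have d₂ := (Real.hasDerivAt_rpow_const (x := t - u₁) (Or.inr hH)).comp_sub_const t u₁
        exact (d₁.sub d₂).hasDerivWithinAt)
      (fun t ht => by
        rw [← mul_sub, norm_mul, Real.norm_of_nonneg (by linarith : 0 ≤ K)]
        exact mul_le_mul_of_nonneg_left (inner t ht) (by linarith))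
      (convex_Ici _) (by simp) (by simp [h₂])
  have e : mu H x u₁ u₂ =
      (1 / 2) * ((x + u₂) ^ K - (x + u₂ - u₁) ^ K - (x ^ K - (x - u₁) ^ K)) := by
    unfold mu
    rw [abs_of_nonneg hd.le, abs_of_nonneg (by linarith : 0 ≤ x + u₂ - u₁)]
    ring
  rw [Real.norm_eq_abs, add_sub_cancel_left, Real.norm_of_nonneg h₂] at outer
  rw [e, abs_mul, abs_of_pos (by norm_num : (0 : ℝ) < 1 / 2)]
  have hp : 0 ≤ u₁ * u₂ * (x - u₁) ^ (K - 2) := by positivity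
  nlinarith [mul_nonneg (by nlinarith : 0 ≤ 2 - K * (K - 1)) hp]

lemma mul_rpow_le_near {K b n M X : ℝ} (hb : 0 ≤ b) (hb' : b ≤ 1) (hKb : K + b ≤ 2)
    (hn : 1 ≤ n) (hM : n ≤ M) (hX : 1 ≤ X) (hXM : X ≤ 4 * M) :
    n * M ^ (K - 1) ≤ 4 * ((n * M) ^ ((K + b) / 2) * X ^ (-b)) := by
  have hn0 : 0 < n := by linarith
  have hM0 : 0 < M := by linarith
  set s := (K + b) / 2 with hs
  have h₁ : n ≤ n ^ s * M ^ (1 - s) := by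
    calc n = n ^ s * n ^ (1 - s) := by rw [← rpow_add hn0]; simp
      _ ≤ n ^ s * M ^ (1 - s) := by
        gcongr
        linarith
  have h₂ : (4 : ℝ)⁻¹ * M ^ (-b) ≤ X ^ (-b) := by
    calc (4 : ℝ)⁻¹ * M ^ (-b) ≤ 4 ^ (-b) * M ^ (-b) := by
          gcongr
          rw [← rpow_neg_one]
          exact rpow_le_rpow_of_exponent_le (by norm_num) (by linarith)
      _ = (4 * M) ^ (-b) := (mul_rpow (by norm_num) hM0.le).symm
      _ ≤ X ^ (-b) := rpow_le_rpow_of_nonpos (by linarith) hXM (by linarith)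
  calc n * M ^ (K - 1) ≤ n ^ s * M ^ (1 - s) * M ^ (K - 1) := by gcongr
    _ = 4 * ((n * M) ^ s * (4⁻¹ * M ^ (-b))) := by
      have : M ^ (1 - s) * M ^ (K - 1) = M ^ s * M ^ (-b) := by
        rw [← rpow_add hM0, ← rpow_add hM0]
        congr 1
        rw [hs]
        ring
      rw [mul_rpow hn0.le hM0.le, mul_assoc, this]
      ring
    _ ≤ _ := by gcongr

lemma mul_rpow_le_far {K b P X : ℝ} (hKb : K + b ≤ 2) (hP : 0 < P) (hX : 0 < X)
    (hPX : P ≤ X ^ 2) :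
    P * X ^ (K - 2) ≤ P ^ ((K + b) / 2) * X ^ (-b) := by
  set s := (K + b) / 2 with hs
  have h₁ : P ≤ P ^ s * X ^ (2 * (1 - s)) := by
    calc P = P ^ s * P ^ (1 - s) := by rw [← rpow_add hP]; simp
      _ ≤ P ^ s * (X ^ 2) ^ (1 - s) := by
        gcongr
        linarith
      _ = P ^ s * X ^ (2 * (1 - s)) := by
        rw [rpow_mul hX.le]
        norm_cast
  calc P * X ^ (K - 2) ≤ P ^ s * X ^ (2 * (1 - s)) * X ^ (K - 2) := by gcongr
    _ = P ^ s * X ^ (-b) := by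
      rw [mul_assoc, ← rpow_add hX]
      congr 2
      rw [hs]
      ring

/-- A bound for the covariance that interpolates between its Cauchy-Schwarz bound and its decay
in `x`. -/
lemma abs_mu_le_s14 {H b x u₁ u₂ : ℝ} (hH : 1 ≤ 2 * H) (hb : 0 ≤ b) (hb' : b ≤ 1)
    (hHb : 2 * H + b ≤ 2) (hx : 0 ≤ x) (h₁ : 0 ≤ u₁) (h₂ : 0 ≤ u₂) :
    |mu H x u₁ u₂| ≤
      48 * (((1 + u₁) * (1 + u₂)) ^ ((2 * H + b) / 2) * (1 + x) ^ (-b)) := by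
  set n := min (1 + u₁) (1 + u₂) with hn
  set M := max (1 + u₁) (1 + u₂) with hM
  have hn1 : 1 ≤ n := le_min (by linarith) (by linarith)
  have hnM : n ≤ M := min_le_max
  have hM₁ : 1 + u₁ ≤ M := le_max_left _ _
  have hM₂ : 1 + u₂ ≤ M := le_max_right _ _
  have hM0 : 0 < M := by linarith
  have hnm : n * M = (1 + u₁) * (1 + u₂) := min_mul_max _ _
  rcases le_or_gt (1 + x) (4 * M) with h | h
  · have near := mul_rpow_le_near hb hb' hHb hn1 hnM (by linarith : 1 ≤ 1 + x) h
    have bound := abs_mu_le_of_le hH hx h₁ h₂ (by linarith : x + u₁ + u₂ ≤ 6 * M)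
    have hmin : min u₁ u₂ ≤ n := min_le_min (by linarith) (by linarith)
    have h6 : (6 * M) ^ (2 * H - 1) ≤ 6 * M ^ (2 * H - 1) := by
      rw [mul_rpow (by norm_num) hM0.le]
      gcongr
      calc (6 : ℝ) ^ (2 * H - 1) ≤ 6 ^ (1 : ℝ) :=
            rpow_le_rpow_of_exponent_le (by norm_num) (by linarith)
        _ = 6 := rpow_one _
    rw [← hnm]
    have hmin0 : 0 ≤ min u₁ u₂ := le_min h₁ h₂
    calc |mu H x u₁ u₂| ≤ 2 * H * (6 * M) ^ (2 * H - 1) * min u₁ u₂ := bound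
      _ ≤ 2 * (6 * M ^ (2 * H - 1)) * n := by
        gcongr
        linarith
      _ = 12 * (n * M ^ (2 * H - 1)) := by ring
      _ ≤ _ := by linarith
  · have far := mul_rpow_le_far (P := (1 + u₁) * (1 + u₂)) (X := 1 + x) hHb (by positivity)
      (by positivity) (by nlinarith)
    have bound := abs_mu_le_of_lt hH (by linarith) h₁ h₂ (by linarith : u₁ < x)
    have h2 : (x - u₁) ^ (2 * H - 2) ≤ 2 * (1 + x) ^ (2 * H - 2) := by
      calc (x - u₁) ^ (2 * H - 2) ≤ (2⁻¹ * (1 + x)) ^ (2 * H - 2) :=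
            rpow_le_rpow_of_nonpos (by positivity) (by linarith) (by linarith)
        _ = 2 ^ (-(2 * H - 2)) * (1 + x) ^ (2 * H - 2) := by
          rw [mul_rpow (by norm_num) (by positivity), inv_rpow (by norm_num),
            rpow_neg (by norm_num)]
        _ ≤ 2 ^ (1 : ℝ) * (1 + x) ^ (2 * H - 2) := by
          gcongr
          · norm_num
          · linarith
        _ = _ := by rw [rpow_one]
    calc |mu H x u₁ u₂| ≤ u₁ * u₂ * (x - u₁) ^ (2 * H - 2) := bound
      _ ≤ (1 + u₁) * (1 + u₂) * (2 * (1 + x) ^ (2 * H - 2)) := by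
        have : 0 ≤ x - u₁ := by linarith
        gcongr <;> first | positivity | linarith
      _ = 2 * ((1 + u₁) * (1 + u₂) * (1 + x) ^ (2 * H - 2)) := by ring
      _ ≤ 2 * (((1 + u₁) * (1 + u₂)) ^ ((2 * H + b) / 2) * (1 + x) ^ (-b)) := by gcongr
      _ ≤ _ := by
        gcongr
        norm_num

lemma one_add_rpow_rpow_le {K r u : ℝ} (hK : 0 ≤ K) (hr : r ≤ 0) (hu : 0 ≤ u) :
    (1 + u ^ K) ^ r ≤ 2 ^ (-(K * r)) * (1 + u) ^ (K * r) := by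
  have hA : ((1 + u) / 2) ^ K ≤ 1 + u ^ K := by
    have hu' : 0 ≤ u ^ K := rpow_nonneg hu K
    rcases le_total u 1 with h | h
    · have : ((1 + u) / 2) ^ K ≤ 1 := rpow_le_one (by positivity) (by linarith) hK
      linarith
    · have : ((1 + u) / 2) ^ K ≤ u ^ K := rpow_le_rpow (by positivity) (by linarith) hK
      linarith
  calc (1 + u ^ K) ^ r ≤ (((1 + u) / 2) ^ K) ^ r :=
        rpow_le_rpow_of_nonpos (by positivity) hA hr
    _ = 2 ^ (-(K * r)) * (1 + u) ^ (K * r) := by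
      rw [← rpow_mul (by positivity), div_rpow (by positivity) (by norm_num),
        rpow_neg (by norm_num), div_eq_inv_mul]

lemma integrableOn_one_add_rpow {c : ℝ} (hc : c < -1) :
    IntegrableOn (fun u : ℝ => (1 + u) ^ c) (Ioi 0) := by
  simpa only [add_comm] using integrableOn_add_rpow_Ioi_of_lt hc (by norm_num : -(1 : ℝ) < 0)

lemma measurable_G (H : ℝ) (q : ℕ) (ε : ℝ) :
    Measurable fun p : ℝ × ℝ × ℝ => G H q ε p.1 p.2.1 p.2.2 := by
  unfold G mu
  fun_prop

/-- For `q ≥ 2` and `3/4 < H < (4q-3)/(4q-2)`, the function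
`(x,u₁,u₂) ↦ G^{(q)}_{1,x}(u₁,u₂)` is integrable on `(0,∞)³`. -/
theorem G_one_integrable (q : ℕ) (hq : 2 ≤ q) (H : ℝ)
    (hH : H ∈ Ioo (3/4 : ℝ) ((4*(q:ℝ) - 3) / (4*(q:ℝ) - 2))) :
    IntegrableOn (fun p : ℝ × ℝ × ℝ => G H q 1 p.1 p.2.1 p.2.2)
      (Ioi (0:ℝ) ×ˢ Ioi (0:ℝ) ×ˢ Ioi (0:ℝ)) volume := by
  obtain ⟨hH₁, hH₂⟩ := hH
  have hq' : (2 : ℝ) ≤ q := by exact_mod_cast hq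
  rw [lt_div_iff₀ (by linarith)] at hH₂
  set m : ℝ := 2 * q - 1 with hm
  have hm3 : 3 ≤ m := by linarith
  have hm_cast : ((2 * q - 1 : ℕ) : ℝ) = m := by
    rw [Nat.cast_sub (by omega)]
    push_cast
    rfl
  obtain ⟨a, ha1, ha2, ha3⟩ : ∃ a, 1 < a ∧ a ≤ m * (2 - 2 * H) ∧ a < 4 * H - 2 := by
    refine ⟨min (m * (2 - 2 * H)) (2 * H - 1 / 2), lt_min ?_ ?_, min_le_left _ _,
      (min_le_right _ _).trans_lt ?_⟩ <;> nlinarith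
  set b := a / m with hb
  have hbm : b * m = a := div_mul_cancel₀ _ (by linarith)
  have hb0 : 0 ≤ b := by positivity
  have hHb : 2 * H + b ≤ 2 := by
    have : b ≤ 2 - 2 * H := (div_le_iff₀ (by linarith)).2 (by linarith)
    linarith
  set r : ℝ := -(1 / 2 : ℝ) - q with hr
  set c : ℝ := a / 2 - 2 * H with hc
  set D : ℝ := 2 ^ (-(2 * H * r)) with hD
  have hexp : 2 * H * r + (2 * H + b) / 2 * m = c := by
    rw [hc, ← hbm, hr, hm]
    ring
  have hdom : IntegrableOn (fun p : ℝ × ℝ × ℝ =>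
      48 ^ (2 * q - 1) * D * D * ((1 + p.1) ^ (-a) * ((1 + p.2.1) ^ c * (1 + p.2.2) ^ c)))
      (Ioi (0:ℝ) ×ˢ Ioi (0:ℝ) ×ˢ Ioi (0:ℝ)) volume := by
    have hu := integrableOn_one_add_rpow (c := c) (by linarith)
    have hx := integrableOn_one_add_rpow (c := -a) (by linarith)
    unfold IntegrableOn at hu hx ⊢
    rw [Measure.volume_eq_prod, Measure.volume_eq_prod, ← Measure.prod_restrict,
      ← Measure.prod_restrict]
    exact (hx.mul_prod (hu.mul_prod hu)).const_mul _
  refine hdom.mono' (measurable_G H q 1).aestronglyMeasurable ?_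
  refine (ae_restrict_mem (measurableSet_Ioi.prod
    (measurableSet_Ioi.prod measurableSet_Ioi))).mono ?_
  rintro ⟨x, u₁, u₂⟩ ⟨hx, h₁, h₂⟩
  simp only [mem_Ioi] at hx h₁ h₂
  have hμ := abs_mu_le_s14 (by linarith) hb0 (by linarith) hHb hx.le h₁.le h₂.le
  have hμm : |mu H x u₁ u₂| ^ (2 * q - 1) ≤ 48 ^ (2 * q - 1) *
      ((1 + u₁) ^ ((2 * H + b) / 2 * m) * (1 + u₂) ^ ((2 * H + b) / 2 * m) *
        (1 + x) ^ (-a)) := by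
    refine (pow_le_pow_left₀ (abs_nonneg _) hμ _).trans_eq ?_
    rw [mul_pow, mul_pow, ← rpow_natCast (_ ^ ((2 * H + b) / 2)), ← rpow_natCast (_ ^ (-b)),
      hm_cast, ← rpow_mul (by positivity), ← rpow_mul (by positivity),
      mul_rpow (by positivity) (by positivity), neg_mul, hbm]
  have hw₁ := one_add_rpow_rpow_le (K := 2 * H) (r := r) (by linarith) (by linarith) h₁.le
  have hw₂ := one_add_rpow_rpow_le (K := 2 * H) (r := r) (by linarith) (by linarith) h₂.le
  rw [G, norm_mul, norm_mul, norm_pow, Real.norm_eq_abs (mu _ _ _ _),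
    Real.norm_of_nonneg (by positivity), Real.norm_of_nonneg (by positivity)]
  calc _ ≤ (D * (1 + u₁) ^ (2 * H * r)) * (D * (1 + u₂) ^ (2 * H * r)) *
        (48 ^ (2 * q - 1) * ((1 + u₁) ^ ((2 * H + b) / 2 * m) *
          (1 + u₂) ^ ((2 * H + b) / 2 * m) * (1 + x) ^ (-a))) := by gcongr
    _ = 48 ^ (2 * q - 1) * D * D * ((1 + x) ^ (-a) *
        (((1 + u₁) ^ (2 * H * r) * (1 + u₁) ^ ((2 * H + b) / 2 * m)) *
          ((1 + u₂) ^ (2 * H * r) * (1 + u₂) ^ ((2 * H + b) / 2 * m)))) := by ring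
    _ = _ := by rw [← rpow_add (by positivity), ← rpow_add (by positivity), hexp]
end
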